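/- IID finite-blocklength bound via Berry–Esseen: for an IID source P_{X^n Y^n Z^n} = P_{XYZ}^n, setting λ = nH(X|Y) + √(nΔ_{X|Y})·Q^{-1}(ε − θ_n) with θ_n = 1/√n + 3ρ/(Δ_{X|Y}^{3/2}√n), we have Pr[−log₂ P_{X^n|Y^n}(X^n|Y^n) > λ] ≤ ε − 1/√n, where Δ_{X|Y} = Var(−log₂ P_{X|Y}(X|Y)), ρ = E[|−log₂ P_{X|Y}(X|Y) − H(X|Y)|³], and Q is the standard Gaussian tail function. -/

import Mathlib

open scoped Classical

/-- Conditional probability `P_{X|Y}(x|y)` of a joint distribution on `X × Y`. -/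
noncomputable def condProb {X Y : Type*} [Fintype X] (P : X × Y → ℝ) (x : X) (y : Y) : ℝ :=
  P (x, y) / ∑ x' : X, P (x', y)

/-- Conditional Shannon entropy `H(X|Y)` of a joint distribution on `X × Y`. -/
noncomputable def condEnt {X Y : Type*} [Fintype X] [Fintype Y] (P : X × Y → ℝ) : ℝ :=
  - ∑ x : X, ∑ y : Y, P (x, y) * Real.logb 2 (condProb P x y)

/-- Standard Gaussian tail function `Q(α) = Pr[N(0,1) > α]`. -/
noncomputable def Qtail (α : ℝ) : ℝ :=
  ∫ x in Set.Ioi α, Real.exp (-x ^ 2 / 2) / Real.sqrt (2 * Real.pi)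

section BEHelpers

open MeasureTheory Set

theorem be_smooth_abs (V : Measure ℝ) [IsProbabilityMeasure V]
    (hsym : ∀ h : ℝ, 0 < h → ∫ y in Icc (-h) h, y ∂V = 0) (c : ℝ)
    (hc : ∀ h : ℝ, 0 < h → V.real (Icc (-h) h)ᶜ ≤ c / h)
    (D : ℝ → ℝ) (hDm : Measurable D) (η : ℝ) (hη : 0 < η) (hD : ∀ x, |D x| ≤ η)
    (m : ℝ) (hm : 0 < m) (hL : ∀ x s, 0 ≤ s → D x - m * s ≤ D (x - s))
    (B : ℝ) (hB : ∀ x, ∫ y, D (x - y) ∂V ≤ B) (x : ℝ) :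
    D x ≤ B + η / 2 + 3 * m * c := by
  set h := η / (2 * m) with hh
  have hpos : 0 < h := by positivity
  set A := Icc (-h) h with hA
  have hAm : MeasurableSet A := measurableSet_Icc
  have hIntg : Integrable (fun y => D (x - h - y)) V := by
    refine Integrable.of_bound (C := η) ?_ (Filter.Eventually.of_forall fun y => ?_)
    · exact (hDm.comp (by fun_prop)).aestronglyMeasurable
    · exact hD _
  have hid : IntegrableOn (fun y : ℝ => y) A V :=
    (continuous_id.continuousOn).integrableOn_compact isCompact_Icc
  have h1 : ∫ y in A, ((D x - η / 2) - m * y) ∂V ≤ ∫ y in A, D (x - h - y) ∂V := by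
    refine setIntegral_mono_on ?_ hIntg.integrableOn hAm ?_
    · exact (integrable_const _).sub (hid.const_mul m)
    · intro y hy
      have := hL x (h + y) (by linarith [hy.1])
      have e : m * h = η / 2 := by rw [hh]; field_simp
      have e2 : x - h - y = x - (h + y) := by ring
      rw [e2]; nlinarith
  have h2 : ∫ y in Aᶜ, (-η) ∂V ≤ ∫ y in Aᶜ, D (x - h - y) ∂V := by
    refine setIntegral_mono_on (integrable_const _) hIntg.integrableOn hAm.compl ?_
    intro y _
    exact (abs_le.mp (hD _)).1
  have h3 := integral_add_compl hAm hIntg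
  have h4 := hB (x - h)
  have h5 : ∫ y in A, ((D x - η / 2) - m * y) ∂V = (D x - η/2) * V.real A := by
    rw [integral_sub (integrable_const _) (hid.const_mul m), integral_const_mul, hsym h hpos]
    simp [mul_comm]
  have h6 : ∫ y in Aᶜ, (-η) ∂V = -η * V.real Aᶜ := by simp [mul_comm]
  have h7 : V.real A = 1 - V.real Aᶜ := by
    rw [probReal_compl_eq_one_sub hAm]; ring
  have h8 := hc h hpos
  have h9 : c / h * η = 2 * m * c := by rw [hh]; field_simp
  have h10 : 0 ≤ V.real Aᶜ := measureReal_nonneg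
  have h11 := (abs_le.mp (hD x)).2
  rw [h7] at h5
  nlinarith

/-- symmetric version -/
theorem be_smooth_abs2 (V : Measure ℝ) [IsProbabilityMeasure V]
    (hneg : V.map (fun y => -y) = V) (c : ℝ) (hc0 : 0 ≤ c)
    (hc : ∀ h : ℝ, 0 < h → V.real (Icc (-h) h)ᶜ ≤ c / h)
    (D : ℝ → ℝ) (hDm : Measurable D) (hD : ∀ x, |D x| ≤ 1)
    (m : ℝ) (hm : 0 < m) (hL : ∀ x s, 0 ≤ s → D x - m * s ≤ D (x - s))
    (B : ℝ) (hB0 : 0 ≤ B) (hB : ∀ x, |∫ y, D (x - y) ∂V| ≤ B) (x : ℝ) :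
    |D x| ≤ 2 * B + 6 * m * c := by
  have hmul : 0 ≤ m * c := by positivity
  have hbdd : BddAbove (range fun x => |D x|) := ⟨1, by rintro _ ⟨x, rfl⟩; exact hD x⟩
  set η := ⨆ x, |D x| with hηd
  have hle : ∀ x, |D x| ≤ η := fun x => le_ciSup hbdd x
  have hη0 : 0 ≤ η := (abs_nonneg _).trans (hle 0)
  rcases hη0.eq_or_lt with h0 | hη
  · have := hle x; linarith
  have key (D : ℝ → ℝ) := be_smooth_abs V ?_ c hc D
  have hA := key D hDm η hη hle m hm hL B (fun x => (abs_le.mp (hB x)).2)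
  have hA' := key (fun x => - D (-x)) (by fun_prop) η hη (fun x => by simpa using hle (-x)) m hm
    (fun x s hs => by
      have := hL (-x + s) s hs
      simp only [add_sub_cancel_right] at this
      have e : -(x - s) = -x + s := by ring
      rw [e]; linarith) B (fun x => by
      have e : ∫ y, - D (-(x - y)) ∂V = - ∫ y, D (-x - y) ∂V := by
        rw [integral_neg]; congr 1
        conv_rhs => rw [← hneg]
        rw [integral_map (by fun_prop) (Measurable.aestronglyMeasurable (by fun_prop))]
        congr 1; ext y; congr 1; ring
      rw [e]
      linarith [(abs_le.mp (hB (-x))).1])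
  · have : η ≤ B + η / 2 + 3 * m * c := by
      refine ciSup_le fun x => abs_le.mpr ⟨?_, hA x⟩
      have := hA' (-x)
      simp only [neg_neg] at this
      linarith
    have := hle x
    linarith
  · intro h _
    have e : ∫ y in Icc (-h) h, y ∂V = - ∫ y in Icc (-h) h, y ∂V := by
      conv_lhs => rw [← hneg]
      rw [setIntegral_map measurableSet_Icc (by fun_prop) (by fun_prop), integral_neg]
      congr 3
      ext y; simp only [mem_preimage, mem_Icc]; constructor <;> rintro ⟨a, b⟩ <;> constructor <;> linarith
    linarith

noncomputable def beV (T y : ℝ) : ℝ := T / (2 * Real.pi) * Real.sinc (T * y / 2) ^ 2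

theorem beV_cont (T : ℝ) : Continuous (beV T) := by
  unfold beV
  have := Real.continuous_sinc
  fun_prop

theorem beV_nonneg {T : ℝ} (hT : 0 < T) (y : ℝ) : 0 ≤ beV T y := by
  unfold beV; positivity

theorem beV_neg (T y : ℝ) : beV T (-y) = beV T y := by
  unfold beV
  rw [show T * -y / 2 = -(T * y / 2) by ring, Real.sinc_neg]

theorem beV_le1 {T : ℝ} (hT : 0 < T) (y : ℝ) : beV T y ≤ T / (2 * Real.pi) := by
  unfold beV
  have := Real.abs_sinc_le_one (T * y / 2)
  have h2 : Real.sinc (T * y / 2) ^ 2 ≤ 1 := by rw [← sq_abs]; exact pow_le_one₀ (abs_nonneg _) this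
  have : 0 ≤ T / (2 * Real.pi) := by positivity
  nlinarith

theorem beV_eq {T : ℝ} (hT : 0 < T) {y : ℝ} (hy : y ≠ 0) :
    beV T y = (1 - Real.cos (T * y)) / (Real.pi * T * y ^ 2) := by
  unfold beV
  rw [Real.sinc_of_ne_zero (by positivity)]
  have : Real.cos (T * y) = 1 - 2 * Real.sin (T * y / 2) ^ 2 := by
    rw [Real.sin_sq, show T * y = 2 * (T * y / 2) by ring, Real.cos_two_mul]; ring_nf
  rw [this]
  field_simp
  ring

theorem beV_le2 {T : ℝ} (hT : 0 < T) {y : ℝ} (hy : y ≠ 0) :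
    beV T y ≤ 2 / (Real.pi * T) * (y ^ 2)⁻¹ := by
  rw [beV_eq hT hy]
  have : 0 < Real.pi * T * y ^ 2 := by positivity
  rw [show 2 / (Real.pi * T) * (y ^ 2)⁻¹ = 2 / (Real.pi * T * y ^ 2) by field_simp]
  gcongr
  linarith [Real.neg_one_le_cos (T * y)]

theorem beV_integrable {T : ℝ} (hT : 0 < T) : Integrable (beV T) := by
  refine Integrable.mono' (integrable_inv_one_add_sq.const_mul (T / (2 * Real.pi) + 2 / (Real.pi * T)))
    (beV_cont T).aestronglyMeasurable (Filter.Eventually.of_forall fun y => ?_)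
  rw [Real.norm_of_nonneg (beV_nonneg hT y), ← div_eq_mul_inv, le_div_iff₀ (by positivity)]
  have h1 := beV_le1 hT y
  by_cases hy : y = 0
  · subst hy
    have : 0 ≤ 2 / (Real.pi * T) := by positivity
    simp; linarith
  have h2 := beV_le2 hT hy
  have h3 : beV T y * y ^ 2 ≤ 2 / (Real.pi * T) := by
    rw [← div_eq_mul_inv, le_div_iff₀ (by positivity)] at h2; exact h2
  linarith

theorem beV_cosint {T : ℝ} (hT : 0 < T) (y : ℝ) :
    ∫ ζ in (0 : ℝ)..T, (1 - ζ / T) * Real.cos (ζ * y) = Real.pi * beV T y := by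
  by_cases hy : y = 0
  · subst hy
    have : ∫ ζ in (0 : ℝ)..T, (1 - ζ / T) * Real.cos (ζ * 0) = T / 2 := by
      simp only [mul_zero, Real.cos_zero, mul_one]
      rw [intervalIntegral.integral_sub (by simp) (by apply Continuous.intervalIntegrable; fun_prop),
        intervalIntegral.integral_div, integral_id]
      simp; field_simp; ring
    rw [this]; simp [beV]; field_simp
  have h : ∀ ζ ∈ uIcc 0 T, HasDerivAt (fun ζ => (1 - ζ / T) * (Real.sin (ζ * y) / y)
      - Real.cos (ζ * y) / (T * y ^ 2)) ((1 - ζ / T) * Real.cos (ζ * y)) ζ := by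
    intro ζ _
    have h1 : HasDerivAt (fun ζ : ℝ => ζ * y) y ζ := by simpa using (hasDerivAt_id ζ).mul_const y
    have h2 := ((hasDerivAt_id ζ).div_const T).const_sub 1
    have := (h2.mul (h1.sin.div_const y)).sub (h1.cos.div_const (T * y ^ 2))
    refine HasDerivAt.congr_deriv (f := fun ζ => (1 - ζ / T) * (Real.sin (ζ * y) / y) - Real.cos (ζ * y) / (T * y ^ 2)) this ?_
    simp only [id]; field_simp; ring
  rw [intervalIntegral.integral_eq_sub_of_hasDerivAt h (by apply Continuous.intervalIntegrable; fun_prop),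
    beV_eq hT hy]
  simp; field_simp; ring

open FourierTransform in
theorem beV_integral {T : ℝ} (hT : 0 < T) : ∫ y, beV T y = 1 := by
  set f : ℝ → ℂ := fun ζ => ((max 0 (1 - |ζ| / T) : ℝ) : ℂ) with hf
  have hfc : Continuous f := by rw [hf]; fun_prop
  have hsupp : ∀ ζ, ζ ∉ Icc (-T) T → f ζ = 0 := by
    intro ζ hζ
    have : T < |ζ| := by
      by_contra h; push Not at h; exact hζ (abs_le.mp h)
    rw [hf]; simp only [Complex.ofReal_eq_zero]
    apply max_eq_left
    rw [sub_nonpos, one_le_div hT]; exact this.le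
  have hfi : Integrable f := hfc.integrable_of_hasCompactSupport
    (HasCompactSupport.intro isCompact_Icc hsupp)
  have hF : ∀ w, 𝓕 f w = ((2 * Real.pi * beV T (w * (2 * Real.pi)) : ℝ) : ℂ) := by
    intro w
    rw [Real.fourier_eq']
    set g : ℝ → ℂ := fun v => Complex.exp (↑(-2 * Real.pi * inner ℝ v w) * Complex.I) • f v with hg
    have hgc : Continuous g := by rw [hg]; fun_prop
    have e1 : ∫ v, g v = ∫ v in (-T)..T, g v := by
      rw [intervalIntegral.integral_of_le (by linarith), ← integral_Icc_eq_integral_Ioc,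
        setIntegral_eq_integral_of_forall_compl_eq_zero]
      intro x hx; simp [hg, hsupp x hx]
    have e2 : ∫ v in (-T)..T, g v = (∫ v in (0:ℝ)..T, g (-v)) + ∫ v in (0:ℝ)..T, g v := by
      rw [intervalIntegral.integral_comp_neg, neg_zero,
        intervalIntegral.integral_add_adjacent_intervals] <;> exact hgc.intervalIntegrable _ _
    rw [e1, e2, ← intervalIntegral.integral_add (by apply Continuous.intervalIntegrable; fun_prop) (hgc.intervalIntegrable _ _)]
    have e3 : ∀ v ∈ uIcc 0 T, g (-v) + g v = ((2 * ((1 - v / T) * Real.cos (v * (w * (2 * Real.pi)))) : ℝ) : ℂ) := by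
      intro v hv
      rw [uIcc_of_le hT.le] at hv
      have hm : max 0 (1 - v / T) = 1 - v / T := by
        apply max_eq_right; rw [sub_nonneg, div_le_one hT]; exact hv.2
      simp only [hg, hf, abs_neg, abs_of_nonneg hv.1, hm]
      rw [smul_eq_mul, smul_eq_mul, ← add_mul]
      have : Complex.exp (↑(-2 * Real.pi * inner ℝ (-v) w) * Complex.I) + Complex.exp (↑(-2 * Real.pi * inner ℝ v w) * Complex.I) = 2 * Complex.cos ((v * (w * (2 * Real.pi)) : ℝ) : ℂ) := by
        rw [Complex.two_cos]
        congr 2 <;> simp <;> ring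
      rw [this]; push_cast; ring
    rw [intervalIntegral.integral_congr e3, intervalIntegral.integral_ofReal,
      intervalIntegral.integral_const_mul, beV_cosint hT]
    congr 1; ring
  have hbi : Integrable (fun w => beV T (w * (2 * Real.pi))) :=
    (beV_integrable hT).comp_mul_right' (by positivity)
  have hFi : Integrable (𝓕 f) := by
    rw [show 𝓕 f = _ from funext hF]
    exact (hbi.const_mul _).ofReal
  have := hfi.fourierInv_fourier_eq hFi (v := 0) hfc.continuousAt
  rw [Real.fourierInv_eq'] at this
  simp only [hF] at this
  simp only [inner_zero_right, mul_zero, Complex.ofReal_zero, zero_mul, Complex.exp_zero, one_smul] at this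
  rw [integral_complex_ofReal, integral_const_mul, Measure.integral_comp_mul_right] at this
  simp [hf] at this
  rw [abs_of_pos Real.pi_pos] at this
  have h2 : ((2 * Real.pi * (Real.pi⁻¹ * 2⁻¹ * ∫ y, beV T y) : ℝ) : ℂ) = ((1:ℝ) : ℂ) := by
    push_cast; exact this
  have h3 := Complex.ofReal_injective h2
  field_simp at h3
  linarith

theorem beV_half {T : ℝ} (hT : 0 < T) : ∫ y in Ioi 0, beV T y = 1 / 2 := by
  have h1 : ∫ y in Iic (0:ℝ), beV T y = ∫ y in Ioi 0, beV T y := by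
    have := integral_comp_neg_Ioi (0 : ℝ) (beV T)
    simp only [beV_neg, neg_zero] at this
    exact this.symm
  have h2 := intervalIntegral.integral_Iic_add_Ioi (b := (0:ℝ)) (beV_integrable hT).integrableOn (beV_integrable hT).integrableOn
  rw [beV_integral hT] at h2
  linarith

theorem beV_sinint {T : ℝ} (hT : 0 < T) (z : ℝ) :
    ∫ y in Ioi z, beV T y = 1 / 2 - 1 / Real.pi * ∫ ζ in (0:ℝ)..T, (1 - ζ / T) * (z * Real.sinc (ζ * z)) := by
  have h1 := intervalIntegral.integral_Ioi_sub_Ioi' (a := 0) (b := z) (μ := volume) (f := beV T)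
    (beV_integrable hT).integrableOn (beV_integrable hT).integrableOn
  rw [beV_half hT] at h1
  have h2 : ∀ ζ : ℝ, ∫ y in (0:ℝ)..z, Real.cos (ζ * y) = z * Real.sinc (ζ * z) := by
    intro ζ
    by_cases hζ : ζ = 0
    · subst hζ; simp
    by_cases hz : z = 0
    · subst hz; simp
    rw [intervalIntegral.integral_comp_mul_left _ hζ, integral_cos, Real.sinc_of_ne_zero (by positivity)]
    simp; field_simp
  have h3 : ∫ y in (0:ℝ)..z, beV T y = 1 / Real.pi * ∫ ζ in (0:ℝ)..T, (1 - ζ / T) * (z * Real.sinc (ζ * z)) := by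
    simp_rw [← h2, ← intervalIntegral.integral_const_mul (μ := volume) (a := (0:ℝ)) (b := z)]
    rw [intervalIntegral_intervalIntegral_swap]
    · rw [← intervalIntegral.integral_const_mul]
      simp_rw [intervalIntegral.integral_const_mul, ← intervalIntegral.integral_const_mul (μ := volume) (a := (0:ℝ)) (b := z)]
      congr 1; ext y
      rw [beV_cosint hT]; field_simp
    · have hc : Continuous (Function.uncurry fun x y => (1 - x / T) * Real.cos (x * y)) := by fun_prop
      exact (hc.continuousOn.integrableOn_compact (isCompact_uIcc.prod isCompact_uIcc)).mono_set (prod_mono uIoc_subset_uIcc uIoc_subset_uIcc)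
  linarith

noncomputable def beM (T : ℝ) : Measure ℝ := volume.withDensity (fun y => ENNReal.ofReal (beV T y))

theorem beM_real {T : ℝ} (hT : 0 < T) {s : Set ℝ} (hs : MeasurableSet s) :
    (beM T).real s = ∫ y in s, beV T y := by
  rw [measureReal_def, beM, withDensity_apply _ hs,
    ← ofReal_integral_eq_lintegral_ofReal (beV_integrable hT).integrableOn
      (Filter.Eventually.of_forall fun y => beV_nonneg hT y), ENNReal.toReal_ofReal]
  exact integral_nonneg fun y => beV_nonneg hT y

theorem beM_prob {T : ℝ} (hT : 0 < T) : IsProbabilityMeasure (beM T) := by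
  constructor
  rw [beM, withDensity_apply _ MeasurableSet.univ, Measure.restrict_univ,
    ← ofReal_integral_eq_lintegral_ofReal (beV_integrable hT)
      (Filter.Eventually.of_forall fun y => beV_nonneg hT y), beV_integral hT]
  simp

theorem beM_neg (T : ℝ) : (beM T).map (fun y => -y) = beM T := by
  ext s hs
  have hm : Measurable (fun y : ℝ => -y) := by fun_prop
  rw [Measure.map_apply hm hs, beM, withDensity_apply _ hs, withDensity_apply _ (hm hs)]
  have := (Measure.measurePreserving_neg (volume : Measure ℝ)).setLIntegral_comp_preimage hs
    (f := fun y => ENNReal.ofReal (beV T y)) (by have := (beV_cont T).measurable; fun_prop)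
  rw [← this]
  simp only [beV_neg]

theorem beM_tail {T : ℝ} (hT : 0 < T) (h : ℝ) (hh : 0 < h) :
    (beM T).real (Icc (-h) h)ᶜ ≤ (4 / (Real.pi * T)) / h := by
  have := beM_prob hT
  have h1 : ∫ y in Ioi h, beV T y ≤ 2 / (Real.pi * T) / h := by
    have e : ∫ y in Ioi h, 2 / (Real.pi * T) * y ^ (-2 : ℝ) = 2 / (Real.pi * T) / h := by
      rw [integral_const_mul, integral_Ioi_rpow_of_lt (by norm_num) hh]
      norm_num [Real.rpow_neg_one]; field_simp
    rw [← e]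
    refine setIntegral_mono_on (beV_integrable hT).integrableOn
      ((integrableOn_Ioi_rpow_of_lt (by norm_num) hh).const_mul _) measurableSet_Ioi ?_
    intro y hy
    have hy0 : 0 < y := hh.trans hy
    refine (beV_le2 hT hy0.ne').trans_eq ?_
    rw [Real.rpow_neg hy0.le]; norm_num
  have h2 : (beM T).real (Iio (-h)) = (beM T).real (Ioi h) := by
    conv_lhs => rw [← beM_neg T]
    rw [map_measureReal_apply (by fun_prop) measurableSet_Iio]
    congr 1; ext y; simp
  have h3 : (Icc (-h) h)ᶜ ⊆ Iio (-h) ∪ Ioi h := by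
    intro y hy
    simp only [mem_compl_iff, mem_Icc, not_and_or, not_le] at hy
    exact hy
  calc (beM T).real (Icc (-h) h)ᶜ ≤ (beM T).real (Iio (-h) ∪ Ioi h) := measureReal_mono h3
    _ ≤ (beM T).real (Iio (-h)) + (beM T).real (Ioi h) := measureReal_union_le _ _
    _ ≤ 2 / (Real.pi * T) / h + 2 / (Real.pi * T) / h := by
        rw [h2, beM_real hT measurableSet_Ioi]; linarith
    _ = _ := by ring

theorem be_tail_meas (μ : Measure ℝ) [IsProbabilityMeasure μ] :
    Measurable fun x => μ.real (Ioi x) := by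
  apply Antitone.measurable
  intro a b hab
  exact measureReal_mono (Ioi_subset_Ioi hab)

theorem be_conv (μ V : Measure ℝ) [IsProbabilityMeasure μ] [IsProbabilityMeasure V] (x : ℝ) :
    ∫ y, μ.real (Ioi (x - y)) ∂V = ∫ s, V.real (Ioi (x - s)) ∂μ := by
  have hs : MeasurableSet {p : ℝ × ℝ | x < p.1 + p.2} :=
    measurableSet_lt measurable_const (by fun_prop)
  have h1 := Measure.prod_apply (μ := V) (ν := μ) hs
  have h2 := Measure.prod_apply_symm (μ := V) (ν := μ) hs
  have e1 : ∀ y, (Prod.mk y ⁻¹' {p : ℝ × ℝ | x < p.1 + p.2}) = Ioi (x - y) := by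
    intro y; ext s; simp [sub_lt_iff_lt_add']
  have e2 : ∀ s : ℝ, ((fun y => (y, s)) ⁻¹' {p : ℝ × ℝ | x < p.1 + p.2}) = Ioi (x - s) := by
    intro y; ext s; simp [sub_lt_iff_lt_add]
  simp only [e1] at h1
  simp only [e2] at h2
  have m1 : ∀ (κ : Measure ℝ) [IsProbabilityMeasure κ], Measurable fun y => κ (Ioi (x - y)) := by
    intro κ _
    apply Monotone.measurable
    intro a b hab
    exact measure_mono (Ioi_subset_Ioi (by linarith))
  simp only [measureReal_def]
  rw [integral_toReal (m1 μ).aemeasurable (Filter.Eventually.of_forall fun y => measure_lt_top _ _),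
    integral_toReal (m1 V).aemeasurable (Filter.Eventually.of_forall fun y => measure_lt_top _ _),
    ← h1, ← h2]

theorem be_conv_sin (μ : Measure ℝ) [IsProbabilityMeasure μ] (hμ : Integrable (fun s : ℝ => s) μ)
    {T : ℝ} (hT : 0 < T) (x : ℝ) :
    IntervalIntegrable (fun ζ => ∫ s, (1 - ζ / T) * ((x - s) * Real.sinc (ζ * (x - s))) ∂μ) volume 0 T ∧
    ∫ y, μ.real (Ioi (x - y)) ∂(beM T) =
     1 / 2 - 1 / Real.pi * ∫ ζ in (0:ℝ)..T, ∫ s, (1 - ζ / T) * ((x - s) * Real.sinc (ζ * (x - s))) ∂μ := by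
  have := beM_prob hT
  have hIntg : Integrable (Function.uncurry fun ζ s => (1 - ζ / T) * ((x - s) * Real.sinc (ζ * (x - s))))
      ((volume.restrict (Set.uIoc 0 T)).prod μ) := by
    have hb : Integrable (fun p : ℝ × ℝ => 1 * (x - p.2)) ((volume.restrict (Set.uIoc 0 T)).prod μ) := by
      have h1 : Integrable (fun s : ℝ => (1:ℝ)) (volume.restrict (Set.uIoc 0 T)) := by
        rw [uIoc_of_le hT.le]; exact integrable_const _
      exact h1.mul_prod ((integrable_const x).sub hμ)
    refine hb.mono ?_ ?_
    · have := Real.continuous_sinc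
      apply Continuous.aestronglyMeasurable
      unfold Function.uncurry
      fun_prop
    · have hae : ∀ᵐ p : ℝ × ℝ ∂((volume.restrict (Set.uIoc 0 T)).prod μ), p.1 ∈ Set.uIoc 0 T := by
        have := (ae_restrict_mem (μ := (volume : Measure ℝ)) (s := Set.uIoc 0 T) measurableSet_uIoc)
        exact Measure.quasiMeasurePreserving_fst.ae this
      filter_upwards [hae] with p hp
      rw [uIoc_of_le hT.le] at hp
      simp only [Function.uncurry, norm_mul, Real.norm_eq_abs, norm_one]
      have a1 : |1 - p.1 / T| ≤ 1 := by
        have : p.1 / T ≤ 1 := by rw [div_le_one hT]; exact hp.2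
        have : 0 ≤ p.1 / T := div_nonneg hp.1.le hT.le
        rw [abs_le]; constructor <;> linarith
      have a2 := Real.abs_sinc_le_one (p.1 * (x - p.2))
      have a3 : |x - p.2| * |Real.sinc (p.1 * (x - p.2))| ≤ |x - p.2| :=
        mul_le_of_le_one_right (abs_nonneg _) a2
      exact mul_le_mul a1 a3 (by positivity) (by norm_num)
  constructor
  · rw [intervalIntegrable_iff]
    exact hIntg.integral_prod_left
  rw [be_conv, intervalIntegral_integral_swap hIntg]
  have e : ∀ s, (beM T).real (Ioi (x - s)) = 1 / 2 - 1 / Real.pi * ∫ ζ in (0:ℝ)..T, (1 - ζ / T) * ((x - s) * Real.sinc (ζ * (x - s))) := by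
    intro s
    rw [beM_real hT measurableSet_Ioi, beV_sinint hT]
  simp only [e]
  rw [integral_sub (integrable_const _), integral_const_mul]
  · simp
  · refine Integrable.const_mul ?_ _
    have := hIntg.integral_prod_right
    simpa [intervalIntegral.integral_of_le hT.le, uIoc_of_le hT.le] using this

theorem be_sin_charFun (μ : Measure ℝ) [IsProbabilityMeasure μ] (x ζ : ℝ) (hζ : 0 < ζ) :
    ∫ s, (x - s) * Real.sinc (ζ * (x - s)) ∂μ
      = (-(Complex.exp (-(ζ * x * Complex.I)) * charFun μ ζ).im) / ζ := by
  have h1 : ∀ s, (x - s) * Real.sinc (ζ * (x - s)) = Real.sin (ζ * (x - s)) / ζ := by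
    intro s
    by_cases h : x - s = 0
    · simp [h]
    rw [Real.sinc_of_ne_zero (mul_ne_zero hζ.ne' h)]; field_simp
  simp only [h1]
  rw [integral_div, charFun_apply_real, ← integral_const_mul]
  congr 1
  have hi : Integrable (fun s : ℝ => Complex.exp (-(ζ * x * Complex.I)) * Complex.exp (ζ * s * Complex.I)) μ := by
    refine Integrable.of_bound (C := 1) (by apply Continuous.aestronglyMeasurable; fun_prop) (Filter.Eventually.of_forall fun s => ?_)
    rw [← Complex.exp_add, Complex.norm_exp]
    simp
  have := (integral_im hi)
  simp only [RCLike.im_to_complex] at this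
  rw [← this, ← integral_neg]
  congr 1; ext s
  rw [← Complex.exp_add, show -((ζ:ℂ) * x * Complex.I) + ζ * s * Complex.I = ((-(ζ * (x - s)) : ℝ) : ℂ) * Complex.I by push_cast; ring,
    Complex.exp_ofReal_mul_I_im, Real.sin_neg, neg_neg]

theorem be_smoothing (μ ν : Measure ℝ) [IsProbabilityMeasure μ] [IsProbabilityMeasure ν]
    (hμ : Integrable (fun s : ℝ => s) μ) (hν : Integrable (fun s : ℝ => s) ν)
    (m : ℝ) (hm : 0 < m) (hL : ∀ x s, 0 ≤ s → ν.real (Ioi (x - s)) ≤ ν.real (Ioi x) + m * s)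
    {T : ℝ} (hT : 0 < T) (g : ℝ → ℝ) (hg : IntervalIntegrable g volume 0 T)
    (hgb : ∀ ζ, 0 < ζ → ζ ≤ T → ‖charFun μ ζ - charFun ν ζ‖ ≤ ζ * g ζ) (x : ℝ) :
    |μ.real (Ioi x) - ν.real (Ioi x)| ≤ 2 / Real.pi * (∫ ζ in (0:ℝ)..T, g ζ) + 24 * m / (Real.pi * T) := by
  have hp := beM_prob hT
  have hg0 : ∀ ζ ∈ Ioc 0 T, 0 ≤ g ζ := by
    intro ζ hζ
    have := (norm_nonneg _).trans (hgb ζ hζ.1 hζ.2)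
    exact nonneg_of_mul_nonneg_right this hζ.1
  have hI0 : 0 ≤ ∫ ζ in (0:ℝ)..T, g ζ := by
    rw [intervalIntegral.integral_of_le hT.le]
    exact setIntegral_nonneg measurableSet_Ioc hg0
  have hbd : ∀ (κ : Measure ℝ) [IsProbabilityMeasure κ] (x : ℝ), Integrable (fun y => κ.real (Ioi (x - y))) (beM T) := by
    intro κ _ x
    refine Integrable.of_bound (C := 1) ?_ (Filter.Eventually.of_forall fun y => ?_)
    · exact ((be_tail_meas κ).comp (measurable_const.sub measurable_id)).aestronglyMeasurable
    · rw [Real.norm_of_nonneg measureReal_nonneg]; exact measureReal_le_one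
  have key := be_smooth_abs2 (beM T) (beM_neg T) (4 / (Real.pi * T)) (by positivity) (beM_tail hT)
    (fun x => μ.real (Ioi x) - ν.real (Ioi x)) ((be_tail_meas μ).sub (be_tail_meas ν))
    (fun x => by
      have a1 : μ.real (Ioi x) ≤ 1 := measureReal_le_one
      have a2 : ν.real (Ioi x) ≤ 1 := measureReal_le_one
      have a3 : 0 ≤ μ.real (Ioi x) := measureReal_nonneg
      have a4 : 0 ≤ ν.real (Ioi x) := measureReal_nonneg
      rw [abs_le]; constructor <;> linarith)
    m hm (fun x s hs => by
      have := hL x s hs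
      have : μ.real (Ioi x) ≤ μ.real (Ioi (x - s)) := measureReal_mono (Ioi_subset_Ioi (by linarith))
      linarith)
    (1 / Real.pi * ∫ ζ in (0:ℝ)..T, g ζ) (by positivity) (fun x => by
      rw [integral_sub (hbd μ x) (hbd ν x)]
      obtain ⟨i1, e1⟩ := be_conv_sin μ hμ hT x
      obtain ⟨i2, e2⟩ := be_conv_sin ν hν hT x
      rw [e1, e2, show ∀ a b c : ℝ, a - b * c - (a - b * (∫ ζ in (0:ℝ)..T, ∫ s, (1 - ζ / T) * ((x - s) * Real.sinc (ζ * (x - s))) ∂ν)) = b * ((∫ ζ in (0:ℝ)..T, ∫ s, (1 - ζ / T) * ((x - s) * Real.sinc (ζ * (x - s))) ∂ν) - c) by intros; ring,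
        ← intervalIntegral.integral_sub i2 i1, abs_mul, abs_of_pos (by positivity : 0 < 1 / Real.pi)]
      refine mul_le_mul_of_nonneg_left ?_ (by positivity)
      rw [← Real.norm_eq_abs]
      refine intervalIntegral.norm_integral_le_of_norm_le hT.le (Filter.Eventually.of_forall fun ζ hζ => ?_) hg
      rw [integral_const_mul, integral_const_mul, be_sin_charFun _ _ _ hζ.1, be_sin_charFun _ _ _ hζ.1, ← mul_sub, norm_mul]
      have a1 : ‖1 - ζ / T‖ ≤ 1 := by
        have : ζ / T ≤ 1 := by rw [div_le_one hT]; exact hζ.2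
        have : 0 ≤ ζ / T := div_nonneg hζ.1.le hT.le
        rw [Real.norm_eq_abs, abs_le]; constructor <;> linarith
      refine (mul_le_of_le_one_left (norm_nonneg _) a1).trans ?_
      rw [← sub_div, norm_div, Real.norm_of_nonneg hζ.1.le, div_le_iff₀ hζ.1, mul_comm (g ζ)]
      refine le_trans ?_ (hgb ζ hζ.1 hζ.2)
      rw [neg_sub_neg, ← Complex.sub_im, ← mul_sub]
      refine (Complex.abs_im_le_norm _).trans ?_
      rw [norm_mul, Complex.norm_exp]
      simp) x
  refine key.trans_eq ?_
  ring

theorem be_taylor_pos (x : ℝ) (hx : 0 ≤ x) :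
    ‖Complex.exp (x * Complex.I) - 1 - x * Complex.I + x ^ 2 / 2‖ ≤ x ^ 3 / 6 := by
  have hd : ∀ y : ℝ, HasDerivAt (fun y : ℝ => Complex.exp (y * Complex.I)) (Complex.exp (y * Complex.I) * Complex.I) y := by
    intro y
    have h1 : HasDerivAt (fun y : ℝ => (y : ℂ) * Complex.I) Complex.I y := by
      simpa using (Complex.ofRealCLM.hasDerivAt (x := y)).mul_const Complex.I
    exact h1.cexp
  have hI : ∀ y : ℝ, HasDerivAt (fun y : ℝ => (y : ℂ) * Complex.I) Complex.I y := by
    intro y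
    simpa using (Complex.ofRealCLM.hasDerivAt (x := y)).mul_const Complex.I
  have hS : ∀ y : ℝ, HasDerivAt (fun y : ℝ => (y : ℂ) ^ 2 / 2) (y : ℂ) y := by
    intro y
    have := ((Complex.ofRealCLM.hasDerivAt (x := y)).pow 2).div_const 2
    refine HasDerivAt.congr_deriv (f := fun y : ℝ => (y : ℂ) ^ 2 / 2) this ?_
    simp
  have h2 : ∀ y : ℝ, 0 ≤ y → ‖Complex.exp (y * Complex.I) - 1 - y * Complex.I‖ ≤ y ^ 2 / 2 := by
    intro y hy
    refine image_norm_le_of_norm_deriv_right_le_deriv_boundary (a := 0) (b := y)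
      (f := fun y : ℝ => Complex.exp (y * Complex.I) - 1 - y * Complex.I)
      (f' := fun y : ℝ => Complex.exp (y * Complex.I) * Complex.I - Complex.I)
      (B := fun y => y ^ 2 / 2) (B' := fun y => y) (by fun_prop) ?_ (by simp) ?_ ?_ ⟨hy, le_rfl⟩
    · intro z _
      exact (((hd z).sub_const 1).sub (hI z)).hasDerivWithinAt
    · intro z
      refine HasDerivAt.congr_deriv ((hasDerivAt_pow 2 z).div_const 2) (by simp)
    · intro z hz
      rw [show Complex.exp (z * Complex.I) * Complex.I - Complex.I = (Complex.exp (Complex.I * z) - 1) * Complex.I by rw [mul_comm (z:ℂ)]; ring, norm_mul, Complex.norm_I, mul_one]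
      refine (Real.norm_exp_I_mul_ofReal_sub_one_le).trans_eq ?_
      rw [Real.norm_of_nonneg hz.1]
  refine image_norm_le_of_norm_deriv_right_le_deriv_boundary (a := 0) (b := x)
      (f := fun y : ℝ => Complex.exp (y * Complex.I) - 1 - y * Complex.I + (y:ℂ) ^ 2 / 2)
      (f' := fun y : ℝ => Complex.exp (y * Complex.I) * Complex.I - Complex.I + y)
      (B := fun y => y ^ 3 / 6) (B' := fun y => y ^ 2 / 2) (by fun_prop) ?_ (by simp) ?_ ?_ ⟨hx, le_rfl⟩
  · intro z _
    exact ((((hd z).sub_const 1).sub (hI z)).add (hS z)).hasDerivWithinAt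
  · intro z
    refine HasDerivAt.congr_deriv ((hasDerivAt_pow 3 z).div_const 6) (by norm_num; ring)
  · intro z hz
    have e : Complex.exp (z * Complex.I) * Complex.I - Complex.I + z = (Complex.exp (z * Complex.I) - 1 - z * Complex.I) * Complex.I := by
      linear_combination (z:ℂ) * Complex.I_sq
    rw [e, norm_mul, Complex.norm_I, mul_one]
    exact h2 z hz.1

theorem be_taylor (x : ℝ) :
    ‖Complex.exp (x * Complex.I) - 1 - x * Complex.I + x ^ 2 / 2‖ ≤ |x| ^ 3 / 6 := by
  rcases le_total 0 x with h | h
  · rw [abs_of_nonneg h]; exact be_taylor_pos x h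
  · rw [abs_of_nonpos h]
    have := be_taylor_pos (-x) (by linarith)
    rw [← RCLike.norm_conj] at this
    have e : (starRingEnd ℂ) (Complex.exp ((-x : ℝ) * Complex.I) - 1 - (-x : ℝ) * Complex.I + ((-x : ℝ) : ℂ) ^ 2 / 2)
        = Complex.exp (x * Complex.I) - 1 - x * Complex.I + (x : ℂ) ^ 2 / 2 := by
      have h2 : (starRingEnd ℂ) 2 = 2 := Complex.conj_ofNat 2
      simp [← Complex.exp_conj, h2]
      ring
    rw [e] at this
    exact this

theorem be_exp_bd (u : ℝ) (hu : 0 ≤ u) : |1 - u - Real.exp (-u)| ≤ u ^ 2 / 2 := by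
  have h1 := Real.one_sub_le_exp_neg u
  have h2 := Real.quadratic_le_exp_of_nonneg hu
  have h3 : Real.exp (-u) ≤ 1 - u + u ^ 2 / 2 := by
    rw [Real.exp_neg, inv_le_iff_one_le_mul₀ (Real.exp_pos u)]
    have : 0 ≤ 1 - u + u ^ 2 / 2 := by nlinarith [sq_nonneg (u - 1)]
    nlinarith [mul_le_mul_of_nonneg_left h2 this, pow_nonneg hu 4]
  rw [abs_le]; constructor <;> linarith

section fin
variable {ι : Type*} [Fintype ι] (p x : ι → ℝ)

noncomputable def beφ (p x : ι → ℝ) (s : ℝ) : ℂ := ∑ w, (p w : ℂ) * Complex.exp (s * x w * Complex.I)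

theorem be_beta_ge (hp : ∀ w, 0 ≤ p w) (h0 : ∑ w, p w = 1) (h2 : ∑ w, p w * x w ^ 2 = 1) :
    1 ≤ ∑ w, p w * |x w| ^ 3 := by
  have : ∑ w, p w * ((3 * x w ^ 2 - 1) / 2) ≤ ∑ w, p w * |x w| ^ 3 := by
    refine Finset.sum_le_sum fun w _ => mul_le_mul_of_nonneg_left ?_ (hp w)
    rw [← sq_abs]
    nlinarith [abs_nonneg (x w), sq_nonneg (|x w| - 1), mul_nonneg (abs_nonneg (x w)) (sq_nonneg (|x w| - 1))]
  have e : ∑ w, p w * ((3 * x w ^ 2 - 1) / 2) = 3 / 2 * ∑ w, p w * x w ^ 2 - 1 / 2 * ∑ w, p w := by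
    rw [Finset.mul_sum, Finset.mul_sum, ← Finset.sum_sub_distrib]
    exact Finset.sum_congr rfl fun w _ => by ring
  rw [e, h2, h0] at this
  linarith

theorem be_phi_taylor (hp : ∀ w, 0 ≤ p w) (h0 : ∑ w, p w = 1) (h1 : ∑ w, p w * x w = 0)
    (h2 : ∑ w, p w * x w ^ 2 = 1) (s : ℝ) (hs : 0 ≤ s) :
    ‖beφ p x s - (1 - s ^ 2 / 2 : ℝ)‖ ≤ s ^ 3 / 6 * ∑ w, p w * |x w| ^ 3 := by
  have e : beφ p x s - (1 - s ^ 2 / 2 : ℝ) = ∑ w, (p w : ℂ) * (Complex.exp ((s * x w : ℝ) * Complex.I) - 1 - (s * x w : ℝ) * Complex.I + ((s * x w : ℝ) : ℂ) ^ 2 / 2) := by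
    have h0' : ∑ w, (p w : ℂ) = 1 := by exact_mod_cast h0
    have h1' : ∑ w, (p w : ℂ) * x w = 0 := by exact_mod_cast h1
    have h2' : ∑ w, (p w : ℂ) * (x w : ℂ) ^ 2 = 1 := by exact_mod_cast h2
    have : ∀ w, (p w : ℂ) * (Complex.exp ((s * x w : ℝ) * Complex.I) - 1 - (s * x w : ℝ) * Complex.I + ((s * x w : ℝ) : ℂ) ^ 2 / 2)
      = (p w : ℂ) * Complex.exp (s * x w * Complex.I) - p w - s * Complex.I * (p w * x w) + s ^ 2 / 2 * (p w * (x w : ℂ) ^ 2) := by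
      intro w; push_cast; ring
    simp only [this, Finset.sum_add_distrib, Finset.sum_sub_distrib, ← Finset.mul_sum, h0', h1', h2']
    unfold beφ; push_cast; ring
  rw [e, Finset.mul_sum]
  refine (norm_sum_le _ _).trans (Finset.sum_le_sum fun w _ => ?_)
  rw [norm_mul, Complex.norm_real, Real.norm_of_nonneg (hp w)]
  refine (mul_le_mul_of_nonneg_left (be_taylor _) (hp w)).trans_eq ?_
  rw [abs_mul, abs_of_nonneg hs]; ring

theorem be_pow_diff (a b : ℂ) (M : ℝ) (ha : ‖a‖ ≤ M) (hb : ‖b‖ ≤ M) (k : ℕ) :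
    ‖a ^ (k + 1) - b ^ (k + 1)‖ ≤ (k + 1) * ‖a - b‖ * M ^ k := by
  have hM : 0 ≤ M := (norm_nonneg _).trans ha
  induction k with
  | zero => simp
  | succ k ih =>
    have e : a ^ (k + 1 + 1) - b ^ (k + 1 + 1) = a * (a ^ (k+1) - b ^ (k+1)) + (a - b) * b ^ (k+1) := by ring
    rw [e]
    refine (norm_add_le _ _).trans ?_
    rw [norm_mul, norm_mul, norm_pow]
    have i1 : ‖a‖ * ‖a ^ (k+1) - b ^ (k+1)‖ ≤ M * ((k + 1) * ‖a - b‖ * M ^ k) := by gcongr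
    have i2 : ‖a - b‖ * ‖b‖ ^ (k+1) ≤ ‖a - b‖ * M ^ (k+1) := by gcongr
    refine (add_le_add i1 i2).trans_eq ?_
    push_cast; ring

theorem be_char_bd (hp : ∀ w, 0 ≤ p w) (h0 : ∑ w, p w = 1) (h1 : ∑ w, p w * x w = 0)
    (h2 : ∑ w, p w * x w ^ 2 = 1) (β : ℝ) (hβ : β = ∑ w, p w * |x w| ^ 3) (n : ℕ) (hn : 17 ≤ n)
    (ζ : ℝ) (hζ : 0 < ζ) (hζT : ζ ≤ 4 * Real.sqrt n / (3 * β)) :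
    ‖beφ p x (ζ / Real.sqrt n) ^ n - Complex.exp (-(ζ ^ 2 / 2 : ℝ))‖ ≤
      ζ * ((β / Real.sqrt n / 6 * ζ ^ 2 + 1 / (8 * n) * ζ ^ 3) * Real.exp (-(1/4) * ζ ^ 2)) := by
  have hβ1 : 1 ≤ β := hβ ▸ be_beta_ge p x hp h0 h2
  have hnR : (17:ℝ) ≤ n := by exact_mod_cast hn
  have hn0 : (0:ℝ) < n := by linarith
  set r := Real.sqrt n with hr
  have hr0 : 0 < r := Real.sqrt_pos.mpr hn0
  have hr2 : r ^ 2 = n := Real.sq_sqrt hn0.le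
  set s := ζ / r with hs
  have hs0 : 0 < s := by positivity
  have hsβ : s * β ≤ 4 / 3 := by
    rw [hs, div_mul_eq_mul_div, div_le_iff₀ hr0]
    rw [le_div_iff₀ (by positivity)] at hζT
    linarith
  have hs43 : s ≤ 4 / 3 := by nlinarith
  have hζs : ζ = s * r := by rw [hs]; field_simp
  have ht := be_phi_taylor p x hp h0 h1 h2 s hs0.le
  rw [← hβ] at ht
  set M := Real.exp (-(5/18) * s ^ 2) with hM
  have ha : ‖beφ p x s‖ ≤ M := by
    have q1 : ‖beφ p x s‖ ≤ ‖beφ p x s - (1 - s ^ 2 / 2 : ℝ)‖ + ‖((1 - s ^ 2 / 2 : ℝ) : ℂ)‖ := by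
      have := norm_add_le (beφ p x s - (1 - s ^ 2 / 2 : ℝ)) ((1 - s ^ 2 / 2 : ℝ) : ℂ)
      rwa [sub_add_cancel] at this
    rw [Complex.norm_real, Real.norm_of_nonneg (by nlinarith : 0 ≤ 1 - s ^ 2 / 2)] at q1
    have q2 : s ^ 3 / 6 * β ≤ 2 / 9 * s ^ 2 := by
      have : s ^ 2 * (s * β) ≤ s ^ 2 * (4/3) := by gcongr
      nlinarith
    have q3 := Real.add_one_le_exp (-(5/18) * s ^ 2)
    linarith
  have hb : ‖Complex.exp (-(s ^ 2 / 2 : ℝ))‖ ≤ M := by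
    rw [← Complex.ofReal_neg, Complex.norm_exp_ofReal, hM, Real.exp_le_exp]
    nlinarith [sq_nonneg s]
  have hdiff : ‖beφ p x s - Complex.exp (-(s ^ 2 / 2 : ℝ))‖ ≤ s ^ 3 / 6 * β + s ^ 4 / 8 := by
    have q1 := norm_add_le (beφ p x s - (1 - s ^ 2 / 2 : ℝ)) (((1 - s ^ 2 / 2 : ℝ) : ℂ) - Complex.exp (-(s ^ 2 / 2 : ℝ)))
    rw [sub_add_sub_cancel, ← Complex.ofReal_neg, ← Complex.ofReal_exp, ← Complex.ofReal_sub, Complex.norm_real] at q1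
    have q2 := be_exp_bd (s ^ 2 / 2) (by positivity)
    rw [← Complex.ofReal_neg, ← Complex.ofReal_exp]
    rw [Real.norm_eq_abs] at q1
    have q3 : (s ^ 2 / 2) ^ 2 / 2 = s ^ 4 / 8 := by ring
    linarith
  obtain ⟨k, rfl⟩ : ∃ k, n = k + 1 := ⟨n - 1, by omega⟩
  have hexp : Complex.exp (-(ζ ^ 2 / 2 : ℝ)) = Complex.exp (-(s ^ 2 / 2 : ℝ)) ^ (k + 1) := by
    rw [← Complex.exp_nat_mul]
    congr 1
    rw [hζs, mul_pow, hr2]; push_cast; ring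
  rw [hexp]
  refine (be_pow_diff _ _ M ha hb k).trans ?_
  have hMk : M ^ k ≤ Real.exp (-(1/4) * ζ ^ 2) := by
    rw [hM, ← Real.exp_nat_mul, Real.exp_le_exp, hζs, mul_pow, hr2]
    push_cast at hnR ⊢
    nlinarith [sq_nonneg s, mul_nonneg (sq_nonneg s) (by linarith : (0:ℝ) ≤ k - 16)]
  calc ((k:ℝ) + 1) * ‖beφ p x s - Complex.exp (-(s ^ 2 / 2 : ℝ))‖ * M ^ k
      ≤ ((k:ℝ) + 1) * (s ^ 3 / 6 * β + s ^ 4 / 8) * Real.exp (-(1/4) * ζ ^ 2) := by gcongr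
    _ = _ := by
      push_cast at hr2 ⊢
      rw [← mul_assoc, ← hr2, hs]
      congr 1
      field_simp

end fin

theorem be_int_exp (L c T : ℝ) (hL : 0 ≤ L) (hc : 0 ≤ c) (hT : 0 < T) :
    ∫ ζ in (0:ℝ)..T, (L / 6 * ζ ^ 2 + c * ζ ^ 3) * Real.exp (-(1/4) * ζ ^ 2)
      ≤ L * Real.sqrt Real.pi / 3 + 8 * c := by
  have j2 : IntegrableOn (fun x : ℝ => x ^ (2:ℝ) * Real.exp (-(1/4) * x ^ (2:ℝ))) (Ioi 0) :=
    integrableOn_rpow_mul_exp_neg_mul_rpow (by norm_num) (by norm_num) (by norm_num)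
  have j3 : IntegrableOn (fun x : ℝ => x ^ (3:ℝ) * Real.exp (-(1/4) * x ^ (2:ℝ))) (Ioi 0) :=
    integrableOn_rpow_mul_exp_neg_mul_rpow (by norm_num) (by norm_num) (by norm_num)
  have k2 := integral_rpow_mul_exp_neg_mul_rpow (p := 2) (q := 2) (b := 1/4) (by norm_num) (by norm_num) (by norm_num)
  have k3 := integral_rpow_mul_exp_neg_mul_rpow (p := 2) (q := 3) (b := 1/4) (by norm_num) (by norm_num) (by norm_num)
  have g2 : (1/4 : ℝ) ^ (-(2 + 1) / 2 : ℝ) * (1/2) * Real.Gamma ((2 + 1) / 2) = 2 * Real.sqrt Real.pi := by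
    rw [show ((2:ℝ) + 1) / 2 = 1 / 2 + 1 by norm_num, Real.Gamma_add_one (by norm_num), Real.Gamma_one_half_eq,
      show (1/4 : ℝ) = 2 ^ (-2 : ℝ) by rw [Real.rpow_neg (by norm_num)]; norm_num, ← Real.rpow_mul (by norm_num)]
    norm_num
    ring
  have g3 : (1/4 : ℝ) ^ (-(3 + 1) / 2 : ℝ) * (1/2) * Real.Gamma ((3 + 1) / 2) = 8 := by
    rw [show ((3:ℝ) + 1) / 2 = 1 + 1 by norm_num, Real.Gamma_add_one (by norm_num), Real.Gamma_one,
      show (1/4 : ℝ) = 2 ^ (-2 : ℝ) by rw [Real.rpow_neg (by norm_num)]; norm_num, ← Real.rpow_mul (by norm_num)]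
    norm_num
  rw [g2] at k2
  rw [g3] at k3
  simp only [Real.rpow_ofNat] at j2 j3 k2 k3
  have e : ∀ ζ : ℝ, (L / 6 * ζ ^ 2 + c * ζ ^ 3) * Real.exp (-(1/4) * ζ ^ 2) =
    L / 6 * (ζ ^ 2 * Real.exp (-(1/4) * ζ ^ 2)) + c * (ζ ^ 3 * Real.exp (-(1/4) * ζ ^ 2)) := by intro ζ; ring
  rw [intervalIntegral.integral_of_le hT.le]
  simp only [e]
  have hi : IntegrableOn (fun ζ : ℝ => L / 6 * (ζ ^ 2 * Real.exp (-(1/4) * ζ ^ 2)) + c * (ζ ^ 3 * Real.exp (-(1/4) * ζ ^ 2))) (Ioi 0) :=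
    (j2.const_mul _).add (j3.const_mul _)
  refine (setIntegral_mono_set hi ?_ (Filter.Eventually.of_forall Ioc_subset_Ioi_self)).trans_eq ?_
  · filter_upwards [ae_restrict_mem measurableSet_Ioi] with ζ hζ
    have : 0 < ζ := hζ
    simp only [Pi.zero_apply]; positivity
  · rw [integral_add (j2.const_mul _) (j3.const_mul _), integral_const_mul, integral_const_mul, k2, k3]
    ring

open ProbabilityTheory in
theorem be_gauss_pdf (x : ℝ) : gaussianPDFReal 0 1 x = Real.exp (-x ^ 2 / 2) / Real.sqrt (2 * Real.pi) := by
  rw [gaussianPDFReal]; simp; ring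

open ProbabilityTheory in
theorem be_gauss_real {s : Set ℝ} : (gaussianReal 0 1).real s = ∫ x in s, Real.exp (-x ^ 2 / 2) / Real.sqrt (2 * Real.pi) := by
  rw [measureReal_def, gaussianReal_apply_eq_integral _ (by simp), ENNReal.toReal_ofReal]
  · simp only [be_gauss_pdf]
  · exact integral_nonneg fun _ => gaussianPDFReal_nonneg _ _ _

open ProbabilityTheory in
theorem be_gauss_lip (x s : ℝ) (hs : 0 ≤ s) : (gaussianReal 0 1).real (Ioi (x - s)) ≤
    (gaussianReal 0 1).real (Ioi x) + 1 / Real.sqrt (2 * Real.pi) * s := by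
  have h1 : Ioi (x - s) = Ioc (x - s) x ∪ Ioi x := (Ioc_union_Ioi_eq_Ioi (by linarith)).symm
  have h2 : (gaussianReal 0 1).real (Ioc (x - s) x) ≤ 1 / Real.sqrt (2 * Real.pi) * s := by
    rw [be_gauss_real]
    have : ∫ y in Ioc (x - s) x, Real.exp (-y ^ 2 / 2) / Real.sqrt (2 * Real.pi) ≤ ∫ y in Ioc (x - s) x, 1 / Real.sqrt (2 * Real.pi) := by
      refine setIntegral_mono_on ?_ (integrable_const _) measurableSet_Ioc ?_
      · exact (Continuous.continuousOn (by fun_prop)).integrableOn_Icc.mono_set Ioc_subset_Icc_self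
      · intro y _
        gcongr
        rw [Real.exp_le_one_iff]; nlinarith [sq_nonneg y]
    refine this.trans_eq ?_
    simp [hs, mul_comm]
  rw [h1]
  linarith [measureReal_union_le (μ := gaussianReal 0 1) (Ioc (x - s) x) (Ioi x)]

open ProbabilityTheory in
theorem be_main {ι : Type*} [Fintype ι] (p x : ι → ℝ) (hp : ∀ w, 0 ≤ p w) (h0 : ∑ w, p w = 1)
    (h1 : ∑ w, p w * x w = 0) (h2 : ∑ w, p w * x w ^ 2 = 1) (β : ℝ)
    (hβ : β = ∑ w, p w * |x w| ^ 3) (n : ℕ) (hn : 17 ≤ n) (α : ℝ) :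
    ∑ w ∈ Finset.univ.filter (fun w : Fin n → ι => α < (∑ i, x (w i)) / Real.sqrt n),
      ∏ i, p (w i) ≤ Qtail α + 3 * (β / Real.sqrt n) := by
  have hβ1 : 1 ≤ β := hβ ▸ be_beta_ge p x hp h0 h2
  have hnR : (17:ℝ) ≤ n := by exact_mod_cast hn
  have hn0 : (0:ℝ) < n := by linarith
  have hr0 : 0 < Real.sqrt n := Real.sqrt_pos.mpr hn0
  set q : (Fin n → ι) → ℝ := fun w => ∏ i, p (w i) with hq
  set S : (Fin n → ι) → ℝ := fun w => (∑ i, x (w i)) / Real.sqrt n with hS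
  have hq0 : ∀ w, 0 ≤ q w := fun w => Finset.prod_nonneg fun i _ => hp _
  have hq1 : ∑ w, q w = 1 := by
    have := Fintype.sum_pow p n
    rw [h0, one_pow] at this
    exact this.symm
  set μ : Measure ℝ := ∑ w, ENNReal.ofReal (q w) • Measure.dirac (S w) with hμ
  have hprob : IsProbabilityMeasure μ := by
    constructor
    rw [hμ]
    simp only [Measure.coe_finsetSum, Finset.sum_apply, Measure.smul_apply, measure_univ, smul_eq_mul, mul_one]
    rw [← ENNReal.ofReal_sum_of_nonneg (fun w _ => hq0 w), hq1, ENNReal.ofReal_one]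
  have hdi : ∀ (f : ℝ → ℂ) w, Integrable f (ENNReal.ofReal (q w) • Measure.dirac (S w)) := by
    intro f w
    exact (integrable_dirac (by simp)).smul_measure ENNReal.ofReal_ne_top
  have hid : Integrable (fun s : ℝ => s) μ := by
    rw [hμ, integrable_finsetSum_measure]
    intro w _
    exact (integrable_dirac (by simp)).smul_measure ENNReal.ofReal_ne_top
  have htail : μ.real (Ioi α) = ∑ w ∈ Finset.univ.filter (fun w => α < S w), q w := by
    rw [measureReal_def, hμ]
    simp only [Measure.coe_finsetSum, Finset.sum_apply, Measure.smul_apply, smul_eq_mul]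
    rw [ENNReal.toReal_sum (by intro w _; exact ENNReal.mul_ne_top ENNReal.ofReal_ne_top (measure_ne_top _ _)),
      Finset.sum_filter]
    refine Finset.sum_congr rfl fun w _ => ?_
    rw [Measure.dirac_apply' _ measurableSet_Ioi, ENNReal.toReal_mul, ENNReal.toReal_ofReal (hq0 w)]
    by_cases h : α < S w <;> simp [indicator, h]
  have hchar : ∀ ζ : ℝ, charFun μ ζ = beφ p x (ζ / Real.sqrt n) ^ n := by
    intro ζ
    rw [charFun_apply_real, hμ, integral_finsetSum_measure (fun w _ => hdi _ w), beφ, Fintype.sum_pow]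
    refine Finset.sum_congr rfl fun w _ => ?_
    rw [integral_smul_measure, integral_dirac, ENNReal.toReal_ofReal (hq0 w), Finset.prod_mul_distrib,
      ← Complex.exp_sum, Complex.real_smul]
    congr 1
    · simp [hq]
    · congr 1
      simp only [hS]
      push_cast
      rw [← Finset.sum_mul, ← Finset.mul_sum]
      ring
  have hcharG : ∀ ζ : ℝ, charFun (gaussianReal 0 1) ζ = Complex.exp (-(ζ ^ 2 / 2 : ℝ)) := by
    intro ζ
    rw [charFun_gaussianReal]
    congr 1
    push_cast; ring
  have hT : 0 < 4 * Real.sqrt n / (3 * β) := by positivity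
  have key := be_smoothing μ (gaussianReal 0 1) hid
    ((memLp_id_gaussianReal 1).integrable (by simp))
    (1 / Real.sqrt (2 * Real.pi)) (by positivity) be_gauss_lip hT
    (fun ζ => (β / Real.sqrt n / 6 * ζ ^ 2 + 1 / (8 * n) * ζ ^ 3) * Real.exp (-(1/4) * ζ ^ 2))
    (Continuous.intervalIntegrable (by fun_prop) _ _)
    (fun ζ hζ hζT => by
      rw [hchar, hcharG]
      exact be_char_bd p x hp h0 h1 h2 β hβ n hn ζ hζ hζT) α
  have hIntg := be_int_exp (β / Real.sqrt n) (1 / (8 * n)) _ (by positivity) (by positivity) hT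
  have hG : (gaussianReal 0 1).real (Ioi α) = Qtail α := be_gauss_real
  rw [htail, hG] at key
  have key2 := (abs_le.mp key).2
  set L := β / Real.sqrt n with hL
  have hL0 : 0 < L := by positivity
  have hnL : 1 / (n:ℝ) ≤ L / 4 := by
    have h4 : 4 ≤ Real.sqrt n := Real.le_sqrt_of_sq_le (by linarith)
    have : 1 / (n:ℝ) = 1 / Real.sqrt n * (1 / Real.sqrt n) := by
      rw [← mul_one_div, div_mul_div_comm, Real.mul_self_sqrt hn0.le]; simp
    rw [this]
    have a1 : 1 / Real.sqrt n ≤ 1 / 4 := by gcongr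
    have a2 : 1 / Real.sqrt n ≤ L := by rw [hL]; gcongr
    have a3 : 0 < 1 / Real.sqrt n := by positivity
    nlinarith
  have hTe : 24 * (1 / Real.sqrt (2 * Real.pi)) / (Real.pi * (4 * Real.sqrt n / (3 * β)))
      = 18 * L / Real.sqrt (2 * Real.pi) / Real.pi := by
    rw [hL]; field_simp; norm_num
  have hpi := Real.pi_gt_d2
  have hpi2 := Real.pi_lt_d2
  have s1 : Real.sqrt Real.pi ≤ 1.8 := by
    rw [Real.sqrt_le_left (by norm_num)]; norm_num; linarith
  have s2 : 2.5 ≤ Real.sqrt (2 * Real.pi) := by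
    apply Real.le_sqrt_of_sq_le; norm_num; linarith
  have s3 : 18 * L / Real.sqrt (2 * Real.pi) ≤ 7.2 * L := by
    rw [div_le_iff₀ (by positivity)]; nlinarith
  have hsum : 2 / Real.pi * (L * Real.sqrt Real.pi / 3 + 8 * (1 / (8 * n))) + 18 * L / Real.sqrt (2 * Real.pi) / Real.pi ≤ 3 * L := by
    have e : 2 / Real.pi * (L * Real.sqrt Real.pi / 3 + 8 * (1 / (8 * n))) + 18 * L / Real.sqrt (2 * Real.pi) / Real.pi
      = (2 * L * Real.sqrt Real.pi / 3 + 2 * (1 / n) + 18 * L / Real.sqrt (2 * Real.pi)) / Real.pi := by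
      field_simp
    rw [e, div_le_iff₀ Real.pi_pos]
    nlinarith
  have hm : 2 / Real.pi * (∫ ζ in (0:ℝ)..(4 * Real.sqrt n / (3 * β)), (L / 6 * ζ ^ 2 + 1 / (8 * n) * ζ ^ 3) * Real.exp (-(1/4) * ζ ^ 2))
      ≤ 2 / Real.pi * (L * Real.sqrt Real.pi / 3 + 8 * (1 / (8 * n))) :=
    mul_le_mul_of_nonneg_left hIntg (by positivity)
  rw [hTe] at key2
  linarith

open ProbabilityTheory in
theorem be_Q_pos (α : ℝ) : 0 < Qtail α := by
  have : Qtail α = (gaussianReal 0 1).real (Ioi α) := be_gauss_real.symm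
  rw [this, measureReal_def, ENNReal.toReal_pos_iff]
  refine ⟨?_, measure_lt_top _ _⟩
  have hac := gaussianReal_absolutelyContinuous' 0 (v := 1) (by simp)
  rw [pos_iff_ne_zero]
  intro h
  have := hac h
  simp at this

end BEHelpers

/-- IID finite-blocklength bound via Berry–Esseen: with
`λ = nH(X|Y) + √(nΔ_{X|Y})·Q⁻¹(ε − θ_n)` (expressed via `α` with
`Q(α) = ε − θ_n`), `Pr[−log₂ P_{X^n|Y^n}(X^n|Y^n) > λ] ≤ ε − 1/√n`. -/
theorem berry_esseen_information_spectrum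
    {𝒳 𝒴 : Type*} [Fintype 𝒳] [Fintype 𝒴]
    (n : ℕ) (hn : 0 < n)
    (P : 𝒳 × 𝒴 → ℝ) (hP0 : ∀ w, 0 ≤ P w) (hP1 : ∑ w, P w = 1)
    (ε : ℝ) (hε : 0 < ε) (hε1 : ε < 1)
    -- Δ_{X|Y} : variance of −log₂ P_{X|Y}(X|Y)
    (Δ : ℝ)
    (hΔ : Δ = ∑ w : 𝒳 × 𝒴,
        P w * (- Real.logb 2 (condProb P w.1 w.2) - condEnt P) ^ 2)
    (hΔpos : 0 < Δ)
    -- ρ : third absolute central moment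
    (ρ : ℝ)
    (hρ : ρ = ∑ w : 𝒳 × 𝒴,
        P w * |(- Real.logb 2 (condProb P w.1 w.2)) - condEnt P| ^ 3)
    -- θ_n and α = Q⁻¹(ε − θ_n)
    (θ : ℝ) (hθ : θ = 1 / Real.sqrt n + 3 * ρ / (Δ ^ ((3 : ℝ) / 2) * Real.sqrt n))
    (α : ℝ) (hα : Qtail α = ε - θ)
    (lam : ℝ)
    (hlam : lam = n * condEnt P + Real.sqrt (n * Δ) * α) :
    ∑ xy ∈ Finset.univ.filter
        (fun xy : (Fin n → 𝒳) × (Fin n → 𝒴) =>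
          lam < ∑ i, - Real.logb 2 (condProb P (xy.1 i) (xy.2 i))),
      ∏ i, P (xy.1 i, xy.2 i)
    ≤ ε - 1 / Real.sqrt n := by
  have hsq : 0 < Real.sqrt Δ := Real.sqrt_pos.mpr hΔpos
  have hsq2 : Real.sqrt Δ ^ 2 = Δ := Real.sq_sqrt hΔpos.le
  have hn0 : (0:ℝ) < n := by exact_mod_cast hn
  have hr0 : 0 < Real.sqrt n := Real.sqrt_pos.mpr hn0
  set W : 𝒳 × 𝒴 → ℝ := fun w => - Real.logb 2 (condProb P w.1 w.2) with hW
  have hmean : ∑ w, P w * W w = condEnt P := by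
    rw [Fintype.sum_prod_type, condEnt]
    simp [hW]
  set x : 𝒳 × 𝒴 → ℝ := fun w => (W w - condEnt P) / Real.sqrt Δ with hx
  have h1 : ∑ w, P w * x w = 0 := by
    have : ∀ w, P w * x w = (P w * W w - P w * condEnt P) / Real.sqrt Δ := by
      intro w; rw [hx]; ring
    simp only [this]
    rw [← Finset.sum_div, Finset.sum_sub_distrib, ← Finset.sum_mul, hP1, hmean]
    simp
  have h2 : ∑ w, P w * x w ^ 2 = 1 := by
    have : ∀ w, P w * x w ^ 2 = P w * (W w - condEnt P) ^ 2 / Δ := by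
      intro w; rw [hx]; simp only [div_pow, hsq2]; ring
    simp only [this]
    rw [← Finset.sum_div, ← hΔ, div_self hΔpos.ne']
  have hpow : Δ ^ ((3 : ℝ) / 2) = Real.sqrt Δ ^ 3 := by
    rw [Real.sqrt_eq_rpow, ← Real.rpow_natCast, ← Real.rpow_mul hΔpos.le]
    norm_num
  have hβ : ρ / Δ ^ ((3 : ℝ) / 2) = ∑ w, P w * |x w| ^ 3 := by
    have : ∀ w, P w * |x w| ^ 3 = P w * |W w - condEnt P| ^ 3 / Real.sqrt Δ ^ 3 := by
      intro w; rw [hx]; simp only [abs_div, div_pow, abs_of_pos hsq]; ring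
    simp only [this]
    rw [← Finset.sum_div, ← hρ, hpow]
  have hβ1 : 1 ≤ ρ / Δ ^ ((3 : ℝ) / 2) := hβ ▸ be_beta_ge P x hP0 hP1 h2
  have hθ' : θ = 1 / Real.sqrt n + 3 * ((ρ / Δ ^ ((3 : ℝ) / 2)) / Real.sqrt n) := by
    rw [hθ, div_div]; ring
  have hn17 : 17 ≤ n := by
    have hQ := be_Q_pos α
    have a1 : 1 / Real.sqrt n ≤ (ρ / Δ ^ ((3 : ℝ) / 2)) / Real.sqrt n := by gcongr
    have a2 : 4 * (1 / Real.sqrt n) < 1 := by linarith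
    have a3 : 4 < Real.sqrt n := by
      rw [mul_one_div, div_lt_one hr0] at a2; exact a2
    have a4 : (4:ℝ) ^ 2 < n := by
      rwa [Real.lt_sqrt (by norm_num)] at a3
    have : 16 < n := by
      have : ((16:ℕ):ℝ) < n := by norm_num at a4 ⊢; exact a4
      exact_mod_cast this
    omega
  have key := be_main P x hP0 hP1 h1 h2 _ hβ n hn17 α
  have heq : ∑ xy ∈ Finset.univ.filter
        (fun xy : (Fin n → 𝒳) × (Fin n → 𝒴) =>
          lam < ∑ i, - Real.logb 2 (condProb P (xy.1 i) (xy.2 i))),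
      ∏ i, P (xy.1 i, xy.2 i) =
      ∑ w ∈ Finset.univ.filter (fun w : Fin n → 𝒳 × 𝒴 => α < (∑ i, x (w i)) / Real.sqrt n),
      ∏ i, P (w i) := by
    rw [Finset.sum_filter, Finset.sum_filter]
    symm
    refine Fintype.sum_equiv (Equiv.arrowProdEquivProdArrow (Fin n) (fun _ => 𝒳) (fun _ => 𝒴)) _ _ fun w => ?_
    have hiff : α < (∑ i, x (w i)) / Real.sqrt n ↔
        lam < ∑ i, - Real.logb 2 (condProb P (w i).1 (w i).2) := by
      have e : ∑ i, x (w i) = (∑ i, - Real.logb 2 (condProb P (w i).1 (w i).2) - n * condEnt P) / Real.sqrt Δ := by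
        simp only [hx, hW]
        rw [← Finset.sum_div, Finset.sum_sub_distrib]
        simp
      rw [e, div_div, lt_div_iff₀ (by positivity), hlam, Real.sqrt_mul hn0.le]
      constructor <;> intro h <;> linarith
    exact if_congr hiff rfl rfl
  rw [heq]
  linarith
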